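/- Let P ⊆ ℝ^d be a nonempty polytope, i.e., the convex hull of a finite set of points. Then the collection ℱ of faces of P (the nonempty exposed subsets of P, including P itself) is finite, and for every x ∈ ℝ^d one has ∑_{F ∈ ℱ} (−1)^{dim F} · 1_F(x) = (−1)^{dim P} · 1_{relint P}(x), where 1_A denotes the indicator function of a set A, dim F is the dimension of the affine hull of F, and relint P is the relative interior of P (its interior within its affine hull). -/

import Mathlib

open Filter Topology Module

section Cone

variable {E : Type*} [AddCommGroup E] [Module ℝ E]

/-- A convex cone (not necessarily containing the origin) that is open in its linear span. -/
structure IsOpenCone (C : Set E) : Prop where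
  add_mem : ∀ p ∈ C, ∀ q ∈ C, p + q ∈ C
  smul_mem : ∀ p ∈ C, ∀ t : ℝ, 0 < t → t • p ∈ C
  sub_mem : ∀ p ∈ C, ∀ q ∈ C, ∀ᶠ t in 𝓝[>] (0 : ℝ), p - t • q ∈ C

theorem eventually_pos_add_smul (f : E →ₗ[ℝ] ℝ) {p : E} (hp : 0 < f p) (q : E) :
    ∀ᶠ t in 𝓝[>] (0 : ℝ), 0 < f (p + t • q) := by
  have h : Tendsto (fun t : ℝ => f (p + t • q)) (𝓝[>] 0) (𝓝 (f p)) := by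
    have : Continuous fun t : ℝ => f (p + t • q) := by
      simp only [map_add, map_smul, smul_eq_mul]; fun_prop
    simpa using (this.tendsto 0).mono_left nhdsWithin_le_nhds
  exact h.eventually_const_lt hp

theorem eventually_neg_add_smul (f : E →ₗ[ℝ] ℝ) {p : E} (hp : f p < 0) (q : E) :
    ∀ᶠ t in 𝓝[>] (0 : ℝ), f (p + t • q) < 0 := by
  have := eventually_pos_add_smul (-f) (p := p) (by simpa using hp) q
  simpa only [LinearMap.neg_apply, Left.neg_pos_iff] using this

theorem isOpenCone_empty : IsOpenCone (∅ : Set E) :=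
  ⟨by simp, by simp, by simp⟩

theorem Submodule.isOpenCone (K : Submodule ℝ E) : IsOpenCone (K : Set E) :=
  ⟨fun _ hp _ hq => K.add_mem hp hq, fun _ hp t _ => K.smul_mem t hp,
    fun _ hp _ hq => .of_forall fun t => K.sub_mem hp (K.smul_mem t hq)⟩

theorem isOpenCone_neg (f : E →ₗ[ℝ] ℝ) : IsOpenCone {p | f p < 0} where
  add_mem p hp q hq := by simpa using add_neg hp hq
  smul_mem p hp t ht := by simpa using mul_neg_of_pos_of_neg ht hp
  sub_mem p hp q _ := by
    simpa only [smul_neg, ← sub_eq_add_neg, Set.mem_ofPred_eq] using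
      eventually_neg_add_smul f hp (-q)

theorem isOpenCone_sign (f : E →ₗ[ℝ] ℝ) (s : SignType) :
    IsOpenCone {p | SignType.sign (f p) = s} := by
  cases s with
  | zero =>
    convert (LinearMap.ker f).isOpenCone using 1
    ext
    simp [sign_eq_zero_iff]
  | neg => simpa [sign_eq_neg_one_iff] using isOpenCone_neg f
  | pos => simpa [sign_eq_one_iff] using isOpenCone_neg (-f)

namespace IsOpenCone

variable {C D : Set E}

theorem inter (hC : IsOpenCone C) (hD : IsOpenCone D) : IsOpenCone (C ∩ D) where
  add_mem p hp q hq := ⟨hC.add_mem p hp.1 q hq.1, hD.add_mem p hp.2 q hq.2⟩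
  smul_mem p hp t ht := ⟨hC.smul_mem p hp.1 t ht, hD.smul_mem p hp.2 t ht⟩
  sub_mem p hp q hq := (hC.sub_mem p hp.1 q hq.1).and (hD.sub_mem p hp.2 q hq.2)

theorem biInter {ι : Type*} (s : Finset ι) {A : ι → Set E} (hA : ∀ i ∈ s, IsOpenCone (A i)) :
    IsOpenCone (⋂ i ∈ s, A i) where
  add_mem p hp q hq := by
    simp only [Set.mem_iInter] at *
    exact fun i hi => (hA i hi).add_mem p (hp i hi) q (hq i hi)
  smul_mem p hp t ht := by
    simp only [Set.mem_iInter] at *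
    exact fun i hi => (hA i hi).smul_mem p (hp i hi) t ht
  sub_mem p hp q hq := by
    simp only [Set.mem_iInter] at *
    exact (Filter.eventually_all_finset s).2
      fun i hi => (hA i hi).sub_mem p (hp i hi) q (hq i hi)

end IsOpenCone

/-- The cone cut out of a subspace `K` by the equations `f i = 0` for `i ∈ S` and the strict
inequalities `f i < 0` for `i ∈ T`. -/
def cell {ι : Type*} (K : Submodule ℝ E) (f : ι → E →ₗ[ℝ] ℝ) (S T : Finset ι) : Set E :=
  {l | l ∈ K ∧ (∀ i ∈ S, f i l = 0) ∧ ∀ i ∈ T, f i l < 0}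

theorem isOpenCone_cell {ι : Type*} (K : Submodule ℝ E) (f : ι → E →ₗ[ℝ] ℝ) (S T : Finset ι) :
    IsOpenCone (cell K f S T) := by
  have h := K.isOpenCone.inter <|
    (IsOpenCone.biInter S fun i _ => (LinearMap.ker (f i)).isOpenCone).inter <|
    IsOpenCone.biInter T fun i _ => isOpenCone_neg (f i)
  convert h using 1
  ext l
  simp [cell]

open Classical in
/-- The Euler characteristic with compact support of an open cone: `(-1) ^ dim C`, or `0` if `C`
is empty. -/
noncomputable def coneEuler (C : Set E) : ℝ :=
  if C.Nonempty then (-1) ^ finrank ℝ (Submodule.span ℝ C) else 0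

@[simp] theorem coneEuler_empty : coneEuler (∅ : Set E) = 0 := by simp [coneEuler]

theorem coneEuler_of_nonempty {C : Set E} (h : C.Nonempty) :
    coneEuler C = (-1) ^ finrank ℝ (Submodule.span ℝ C) := if_pos h

namespace IsOpenCone

variable {C : Set E}

theorem coneEuler_inter_neg (hC : IsOpenCone C) (f : E →ₗ[ℝ] ℝ) {p : E} (hp : p ∈ C)
    (hfp : f p < 0) : coneEuler (C ∩ {l | f l < 0}) = coneEuler C := by
  have hspan : Submodule.span ℝ (C ∩ {l | f l < 0}) = Submodule.span ℝ C := by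
    refine le_antisymm (Submodule.span_mono Set.inter_subset_left) (Submodule.span_le.2 ?_)
    intro q hq
    obtain ⟨t, ht, ht0⟩ := ((eventually_neg_add_smul f hfp q).and self_mem_nhdsWithin).exists
    have ht0 : 0 < t := ht0
    have h1 : p ∈ Submodule.span ℝ (C ∩ {l | f l < 0}) := Submodule.subset_span ⟨hp, hfp⟩
    have h2 : p + t • q ∈ Submodule.span ℝ (C ∩ {l | f l < 0}) :=
      Submodule.subset_span ⟨hC.add_mem p hp _ (hC.smul_mem q hq t ht0), ht⟩
    have h3 := Submodule.sub_mem _ h2 h1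
    rw [add_sub_cancel_left] at h3
    exact (Submodule.smul_mem_iff _ ht0.ne').1 h3
  have hne : (C ∩ {l | f l < 0}).Nonempty := ⟨p, hp, hfp⟩
  rw [coneEuler_of_nonempty hne, coneEuler_of_nonempty ⟨p, hp⟩, hspan]

theorem coneEuler_inter_pos (hC : IsOpenCone C) (f : E →ₗ[ℝ] ℝ) {p : E} (hp : p ∈ C)
    (hfp : 0 < f p) : coneEuler (C ∩ {l | 0 < f l}) = coneEuler C := by
  simpa using hC.coneEuler_inter_neg (-f) hp (by simpa using hfp)

theorem coneEuler_inter_ker [FiniteDimensional ℝ E] (hC : IsOpenCone C) (f : E →ₗ[ℝ] ℝ) {p q : E}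
    (hp : p ∈ C) (hfp : 0 < f p) (hq : q ∈ C) (hfq : f q < 0) :
    coneEuler (C ∩ {l | f l = 0}) = -coneEuler C := by
  set U := Submodule.span ℝ (C ∩ {l | f l = 0}) with hU
  have hcomb : ∀ a ∈ C, ∀ b ∈ C, 0 < f a → f b < 0 → (-f b) • a + f a • b ∈ C ∩ {l | f l = 0} := by
    intro a ha b hb hfa hfb
    refine ⟨hC.add_mem _ (hC.smul_mem a ha _ (neg_pos.2 hfb)) _ (hC.smul_mem b hb _ hfa), ?_⟩
    simp only [Set.mem_ofPred_eq, map_add, map_smul, smul_eq_mul]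
    ring
  have hneg : ∀ b ∈ C, f b < 0 → b ∈ U ⊔ ℝ ∙ p := by
    intro b hb hfb
    have h1 : (-f b) • p + f p • b ∈ U ⊔ ℝ ∙ p :=
      Submodule.mem_sup_left (Submodule.subset_span (hcomb p hp b hb hfp hfb))
    have h2 : (-f b) • p ∈ U ⊔ ℝ ∙ p :=
      Submodule.mem_sup_right (Submodule.smul_mem _ _ (Submodule.mem_span_singleton_self p))
    have h3 := Submodule.sub_mem _ h1 h2
    rw [add_sub_cancel_left] at h3
    exact (Submodule.smul_mem_iff _ hfp.ne').1 h3
  have hsup : Submodule.span ℝ C = U ⊔ ℝ ∙ p := by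
    refine le_antisymm (Submodule.span_le.2 fun a ha => ?_)
      (sup_le (Submodule.span_mono Set.inter_subset_left) ?_)
    · rcases lt_trichotomy (f a) 0 with h | h | h
      · exact hneg a ha h
      · exact Submodule.mem_sup_left (Submodule.subset_span ⟨ha, h⟩)
      · have h1 : (-f q) • a + f a • q ∈ U ⊔ ℝ ∙ p :=
          Submodule.mem_sup_left (Submodule.subset_span (hcomb a ha q hq h hfq))
        have h2 := Submodule.sub_mem _ h1 (Submodule.smul_mem _ (f a) (hneg q hq hfq))
        rw [add_sub_cancel_right] at h2
        exact (Submodule.smul_mem_iff _ (neg_pos.2 hfq).ne').1 h2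
    · rw [Submodule.span_singleton_le_iff_mem]
      exact Submodule.subset_span hp
  have hpU : p ∉ U := fun h =>
    hfp.ne' (Submodule.span_le.2 (fun x hx => hx.2) h : p ∈ LinearMap.ker f)
  have hdim : finrank ℝ (Submodule.span ℝ C) = finrank ℝ U + 1 := by
    rw [hsup]
    exact Submodule.finrank_sup_span_singleton hpU
  rw [coneEuler_of_nonempty ⟨_, hcomb p hp q hq hfp hfq⟩, coneEuler_of_nonempty ⟨p, hp⟩, hdim,
    pow_succ]
  ring

theorem exists_neg_of_pos (hC : IsOpenCone C) (f : E →ₗ[ℝ] ℝ) {p q : E} (hp : p ∈ C)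
    (hfp : 0 < f p) (hq : q ∈ C) (hfq : f q = 0) : ∃ r ∈ C, f r < 0 := by
  obtain ⟨t, ht, ht0⟩ := ((hC.sub_mem q hq p hp).and self_mem_nhdsWithin).exists
  have ht0 : 0 < t := ht0
  exact ⟨_, ht, by simpa [hfq] using mul_pos ht0 hfp⟩

theorem coneEuler_eq_sum_sign [FiniteDimensional ℝ E] (hC : IsOpenCone C) (f : E →ₗ[ℝ] ℝ) :
    coneEuler C = ∑ s : SignType, coneEuler (C ∩ {l | SignType.sign (f l) = s}) := by
  have huniv : (Finset.univ : Finset SignType) = {0, -1, 1} := rfl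
  rw [huniv, Finset.sum_insert (by decide), Finset.sum_insert (by decide), Finset.sum_singleton]
  simp only [sign_eq_zero_iff, sign_eq_neg_one_iff, sign_eq_one_iff]
  have hempty {p : ℝ → Prop} (h : ∀ l ∈ C, ¬ p (f l)) : coneEuler (C ∩ {l | p (f l)}) = 0 := by
    rw [Set.eq_empty_of_forall_notMem (s := C ∩ {l | p (f l)}) fun l hl => h l hl.1 hl.2,
      coneEuler_empty]
  by_cases hpos : ∃ p ∈ C, 0 < f p
  · obtain ⟨p, hp, hfp⟩ := hpos
    by_cases hneg : ∃ q ∈ C, f q < 0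
    · obtain ⟨q, hq, hfq⟩ := hneg
      rw [hC.coneEuler_inter_ker f hp hfp hq hfq, hC.coneEuler_inter_neg f hq hfq,
        hC.coneEuler_inter_pos f hp hfp]
      ring
    · rw [hC.coneEuler_inter_pos f hp hfp, hempty (p := fun t => t < 0) (by simpa using hneg),
        hempty (p := fun t => t = 0) fun l hl h0 => hneg (hC.exists_neg_of_pos f hp hfp hl h0)]
      ring
  · by_cases hneg : ∃ q ∈ C, f q < 0
    · obtain ⟨q, hq, hfq⟩ := hneg
      rw [hC.coneEuler_inter_neg f hq hfq, hempty (p := fun t => 0 < t) (by simpa using hpos),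
        hempty (p := fun t => t = 0) fun l hl h0 => hpos ?_]
      · ring
      · simpa using hC.exists_neg_of_pos (-f) hq (by simpa using hfq) hl (by simpa using h0)
    · push Not at hpos hneg
      rw [hempty (p := fun t => t < 0) (by simpa using hneg),
        hempty (p := fun t => 0 < t) (by simpa using hpos),
        (Set.inter_eq_left (t := {l | f l = 0})).2 fun l hl => (hpos l hl).antisymm (hneg l hl)]
      ring

/-- Additivity of the Euler characteristic along a finite partition of an open cone into open
cones whose parts are distinguished by the signs of finitely many functionals. -/
theorem coneEuler_eq_sum_fiber [FiniteDimensional ℝ E] {β : Type*} (B : Finset β) (g : E → β)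
    (T : Finset (E →ₗ[ℝ] ℝ)) (hC : IsOpenCone C) (hB : ∀ p ∈ C, g p ∈ B)
    (hg : ∀ b ∈ B, IsOpenCone (C ∩ {l | g l = b}))
    (hT : ∀ p ∈ C, ∀ q ∈ C, (∀ f ∈ T, SignType.sign (f p) = SignType.sign (f q)) → g p = g q) :
    coneEuler C = ∑ b ∈ B, coneEuler (C ∩ {l | g l = b}) := by
  classical
  induction T using Finset.induction_on generalizing C with
  | empty =>
    rcases C.eq_empty_or_nonempty with rfl | ⟨p, hp⟩
    · simp
    · rw [Finset.sum_eq_single_of_mem (g p) (hB p hp)]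
      · rw [(Set.inter_eq_left (t := {l | g l = g p})).2 fun q hq => hT q hq p hp (by simp)]
      · intro b _ hb
        rw [Set.eq_empty_of_forall_notMem (s := C ∩ _) fun q hq =>
          hb (hq.2.symm.trans (hT q hq.1 p hp (by simp))), coneEuler_empty]
  | insert f T _ ih =>
    rw [hC.coneEuler_eq_sum_sign f, Finset.sum_congr rfl fun b hb =>
      (hg b hb).coneEuler_eq_sum_sign f, Finset.sum_comm]
    refine Finset.sum_congr rfl fun s _ => ?_
    rw [ih (hC.inter (isOpenCone_sign f s)) (fun p hp => hB p hp.1)]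
    · simp only [Set.inter_right_comm]
    · intro b hb
      rw [Set.inter_right_comm]
      exact (hg b hb).inter (isOpenCone_sign f s)
    · intro p hp q hq h
      refine hT p hp.1 q hq.1 fun f' hf' => ?_
      rcases Finset.mem_insert.1 hf' with rfl | hf'
      · exact hp.2.trans hq.2.symm
      · exact h f' hf'

end IsOpenCone
theorem cell_smul {ι : Type*} (K : Submodule ℝ E) (f : ι → E →ₗ[ℝ] ℝ) (S T : Finset ι)
    {c : ι → ℝ} (hS : ∀ i ∈ S, 0 < c i) (hT : ∀ i ∈ T, 0 < c i) :
    cell K (fun i => c i • f i) S T = cell K f S T := by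
  ext l
  refine and_congr_right fun _ => and_congr (forall₂_congr fun i hi => ?_)
    (forall₂_congr fun i hi => ?_)
  · simp [(hS i hi).ne']
  · simp [mul_neg_iff, hT i hi, (hT i hi).le]

theorem sum_coneEuler_cell_of_eq_neg_one [FiniteDimensional ℝ E] {ι : Type*} [DecidableEq ι]
    (K : Submodule ℝ E) (f : ι → E →ₗ[ℝ] ℝ) {I : Finset ι} (hI : I.Nonempty) {l₀ : E}
    (hl₀ : l₀ ∈ K) (hf : ∀ i ∈ I, f i l₀ = -1) :
    ∑ S ∈ I.powerset, coneEuler (cell K f S (I \ S)) = 0 := by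
  classical
  set C := cell K f ∅ I with hCdef
  have hC : IsOpenCone C := isOpenCone_cell K f ∅ I
  set g : E → Finset ι := fun l => I.filter fun i => ∀ j ∈ I, f j l ≤ f i l with hgdef
  have hg_iff (l : E) {S : Finset ι} (hS : S ⊆ I) {s : ι} (hs : s ∈ S) :
      g l = S ↔ (∀ i ∈ S, f i l = f s l) ∧ ∀ i ∈ I \ S, f i l < f s l := by
    constructor
    · rintro rfl
      have hs' := (Finset.mem_filter.1 hs).2
      refine ⟨fun i hi => ?_, fun i hi => ?_⟩
      · exact (hs' i (hS hi)).antisymm ((Finset.mem_filter.1 hi).2 s (hS hs))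
      · obtain ⟨hiI, hi⟩ := Finset.mem_sdiff.1 hi
        refine lt_of_not_ge fun h => hi (Finset.mem_filter.2 ⟨hiI, fun j hj => (hs' j hj).trans h⟩)
    · rintro ⟨h1, h2⟩
      have hle : ∀ j ∈ I, f j l ≤ f s l := fun j hj => by
        by_cases hjS : j ∈ S
        · exact (h1 j hjS).le
        · exact (h2 j (Finset.mem_sdiff.2 ⟨hj, hjS⟩)).le
      ext i
      simp only [hgdef, Finset.mem_filter]
      refine ⟨fun ⟨hiI, hi⟩ => ?_, fun hi => ⟨hS hi, fun j hj => (hle j hj).trans (h1 i hi).ge⟩⟩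
      by_contra hiS
      exact (h2 i (Finset.mem_sdiff.2 ⟨hiI, hiS⟩)).not_ge (hi s (hS hs))
  have hfiber {S : Finset ι} (hS : S ⊆ I) {s : ι} (hs : s ∈ S) :
      C ∩ {l | g l = S} = cell K (fun i => f i - f s) S (I \ S) ∩ {l | f s l < 0} := by
    ext l
    simp only [C, cell, Set.mem_inter_iff, Set.mem_ofPred_eq, hg_iff l hS hs, LinearMap.sub_apply,
      sub_eq_zero, sub_neg, Finset.notMem_empty, false_implies, implies_true, true_and]
    refine ⟨fun ⟨⟨hK, h1⟩, h2⟩ => ⟨⟨hK, h2⟩, h1 s (hS hs)⟩, fun ⟨⟨hK, h2⟩, h1⟩ => ⟨⟨hK, ?_⟩, h2⟩⟩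
    intro i hi
    by_cases hiS : i ∈ S
    · exact (h2.1 i hiS).trans_lt h1
    · exact (h2.2 i (Finset.mem_sdiff.2 ⟨hi, hiS⟩)).trans h1
  have hface {S : Finset ι} {s : ι} (hs : s ∈ S) :
      cell K f S (I \ S) = cell K (fun i => f i - f s) S (I \ S) ∩ {l | f s l = 0} := by
    ext l
    simp only [cell, Set.mem_inter_iff, Set.mem_ofPred_eq, LinearMap.sub_apply]
    refine ⟨fun ⟨hK, h1, h2⟩ => ?_, fun ⟨⟨hK, h1, h2⟩, h0⟩ => ?_⟩
    · have h0 := h1 s hs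
      simpa [h0, hK] using ⟨h1, by simpa using h2⟩
    · simp only [h0, sub_zero] at h1 h2
      exact ⟨hK, h1, h2⟩
  have hempty : C ∩ {l | g l = ∅} = ∅ := by
    refine Set.eq_empty_of_forall_notMem fun l hl => ?_
    obtain ⟨s, hs, hmax⟩ := I.exists_max_image (fun i => f i l) hI
    exact Finset.notMem_empty s (hl.2 ▸ Finset.mem_filter.2 ⟨hs, hmax⟩ : s ∈ (∅ : Finset ι))
  have hsum : coneEuler C = ∑ S ∈ I.powerset, coneEuler (C ∩ {l | g l = S}) := by
    refine hC.coneEuler_eq_sum_fiber _ g ((I ×ˢ I).image fun ij => f ij.1 - f ij.2)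
      (fun p _ => Finset.mem_powerset.2 (Finset.filter_subset _ _)) (fun S hS => ?_) ?_
    · rcases S.eq_empty_or_nonempty with rfl | ⟨s, hs⟩
      · rw [hempty]
        exact isOpenCone_empty
      · rw [hfiber (Finset.mem_powerset.1 hS) hs]
        exact (isOpenCone_cell _ _ _ _).inter (isOpenCone_neg _)
    · intro p _ q _ h
      refine Finset.filter_congr fun i hi => forall₂_congr fun j hj => ?_
      have h' := h (f i - f j) (Finset.mem_image.2 ⟨(i, j), Finset.mk_mem_product hi hj, rfl⟩)
      simp only [LinearMap.sub_apply] at h'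
      rw [← sub_nonneg, ← sub_nonneg (b := f j q), ← sign_nonneg_iff, h', sign_nonneg_iff]
  have hpair : ∀ S ∈ I.powerset, coneEuler (cell K f S (I \ S)) =
      (if S = ∅ then coneEuler C else 0) - coneEuler (C ∩ {l | g l = S}) := by
    intro S hS
    rcases S.eq_empty_or_nonempty with rfl | ⟨s, hs⟩
    · rw [hempty]
      simp [C]
    · have hSI := Finset.mem_powerset.1 hS
      rw [if_neg (Finset.ne_empty_of_mem hs), zero_sub, hface hs, hfiber hSI hs]
      set H := cell K (fun i => f i - f s) S (I \ S) with hH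
      have hHc : IsOpenCone H := isOpenCone_cell _ _ _ _
      rcases H.eq_empty_or_nonempty with h | ⟨p, hp⟩
      · simp [h]
      · have hshift (t : ℝ) : p + t • l₀ ∈ H := by
          refine ⟨K.add_mem hp.1 (K.smul_mem t hl₀), fun i hi => ?_, fun i hi => ?_⟩
          · have := hp.2.1 i hi
            simpa [hf i (hSI hi), hf s (hSI hs)] using this
          · have := hp.2.2 i hi
            simpa [hf i (Finset.mem_sdiff.1 hi).1, hf s (hSI hs)] using this
        have hneg : f s (p + (f s p + 1) • l₀) < 0 := by simp [hf s (hSI hs)]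
        have hpos : 0 < f s (p + (f s p - 1) • l₀) := by simp [hf s (hSI hs)]
        rw [hHc.coneEuler_inter_neg _ (hshift _) hneg,
          hHc.coneEuler_inter_ker _ (hshift _) hpos (hshift _) hneg]
  rw [Finset.sum_congr rfl hpair, Finset.sum_sub_distrib, ← hsum,
    Finset.sum_ite_eq' _ _ _, if_pos (Finset.empty_mem_powerset I), sub_self]

/-- The Euler relation for the polyhedral cone `{l ∈ K | ∀ i ∈ I, f i l ≤ 0}`, when some point
satisfies all the inequalities strictly. -/
theorem sum_coneEuler_cell [FiniteDimensional ℝ E] {ι : Type*} [DecidableEq ι]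
    (K : Submodule ℝ E) (f : ι → E →ₗ[ℝ] ℝ) {I : Finset ι} (hI : I.Nonempty) {l₀ : E}
    (hl₀ : l₀ ∈ K) (hf : ∀ i ∈ I, f i l₀ < 0) :
    ∑ S ∈ I.powerset, coneEuler (cell K f S (I \ S)) = 0 := by
  have hc : ∀ i ∈ I, 0 < (-f i l₀)⁻¹ := fun i hi => inv_pos.2 (neg_pos.2 (hf i hi))
  rw [← sum_coneEuler_cell_of_eq_neg_one K (fun i => (-f i l₀)⁻¹ • f i) hI hl₀]
  · refine Finset.sum_congr rfl fun S hS => ?_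
    rw [cell_smul K f _ _ (fun i hi => hc i (Finset.mem_powerset.1 hS hi))
      fun i hi => hc i (Finset.mem_sdiff.1 hi).1]
  · intro i hi
    have := (hf i hi).ne
    simp only [LinearMap.smul_apply, smul_eq_mul]
    field_simp

theorem span_cell {ι : Type*} (K : Submodule ℝ E) (f : ι → E →ₗ[ℝ] ℝ) (S T : Finset ι)
    (h : (cell K f S T).Nonempty) :
    Submodule.span ℝ (cell K f S T) = K ⊓ ⨅ i ∈ S, LinearMap.ker (f i) := by
  refine le_antisymm (Submodule.span_le.2 fun l hl => ?_) fun m hm => ?_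
  · simpa using And.intro hl.1 hl.2.1
  · obtain ⟨l, hl⟩ := h
    simp only [Submodule.mem_inf, Submodule.mem_iInf, LinearMap.mem_ker] at hm
    obtain ⟨t, ht, ht0⟩ := (((Filter.eventually_all_finset T).2 fun i hi =>
      eventually_neg_add_smul (f i) (hl.2.2 i hi) m).and self_mem_nhdsWithin).exists
    have ht0 : 0 < t := ht0
    have h1 : l + t • m ∈ cell K f S T :=
      ⟨K.add_mem hl.1 (K.smul_mem t hm.1), fun i hi => by simp [hl.2.1 i hi, hm.2 i hi], ht⟩
    have h2 := Submodule.sub_mem _ (Submodule.subset_span (R := ℝ) h1)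
      (Submodule.subset_span (R := ℝ) hl)
    rw [add_sub_cancel_left] at h2
    exact (Submodule.smul_mem_iff _ ht0.ne').1 h2

end Cone

section Face

variable {M : Type*} [NormedAddCommGroup M] [NormedSpace ℝ M]

/-- The face of `P` on which the linear functional `l` is maximal. -/
def maxFace (P : Set M) (l : Dual ℝ M) : Set M := {x ∈ P | ∀ y ∈ P, l y ≤ l x}

theorem mem_maxFace_convexHull {V : Set M} {l : Dual ℝ M} {x : M} (hx : x ∈ convexHull ℝ V) :
    x ∈ maxFace (convexHull ℝ V) l ↔ ∀ v ∈ V, l v ≤ l x :=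
  ⟨fun h v hv => h.2 v (subset_convexHull ℝ V hv),
    fun h => ⟨hx, convexHull_min h (convex_halfSpace_le l.isLinear (l x))⟩⟩

theorem mem_maxFace_of_eq {P : Set M} {l : Dual ℝ M} {x y : M} (hx : x ∈ maxFace P l)
    (hy : y ∈ P) : y ∈ maxFace P l ↔ l y = l x :=
  ⟨fun h => (hx.2 y hy).antisymm (h.2 x hx.1), fun h => ⟨hy, fun z hz => h ▸ hx.2 z hz⟩⟩

theorem maxFace_convexHull (V : Finset M) (l : Dual ℝ M) :
    maxFace (convexHull ℝ (V : Set M)) l =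
      convexHull ℝ ((V : Set M) ∩ maxFace (convexHull ℝ (V : Set M)) l) := by
  classical
  set P := convexHull ℝ (V : Set M) with hP
  refine subset_antisymm (fun x hx => ?_) (convexHull_min Set.inter_subset_right ?_)
  · obtain ⟨a, ha0, ha1, hax⟩ := Finset.mem_convexHull'.1 hx.1
    have hVP : ∀ v ∈ V, v ∈ P := fun v hv => subset_convexHull ℝ _ hv
    have hsum : ∑ v ∈ V, a v * (l x - l v) = 0 := by
      have h1 : l x = ∑ v ∈ V, a v * l v := by
        conv_lhs => rw [← hax]
        simp
      simp only [mul_sub, Finset.sum_sub_distrib, ← Finset.sum_mul, ha1, ← h1]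
      ring
    have hzero := (Finset.sum_eq_zero_iff_of_nonneg fun v hv =>
      mul_nonneg (ha0 v hv) (sub_nonneg.2 (hx.2 v (hVP v hv)))).1 hsum
    have hsupp : ∀ v ∈ V, a v ≠ 0 → v ∈ maxFace P l := fun v hv hav =>
      (mem_maxFace_of_eq hx (hVP v hv)).2
        (sub_eq_zero.1 ((mul_eq_zero.1 (hzero v hv)).resolve_left hav)).symm
    have hcoe : ((V.filter fun v => v ∈ maxFace P l : Finset M) : Set M) =
        (V : Set M) ∩ maxFace P l := by
      ext; simp
    rw [← hcoe]
    refine Finset.mem_convexHull'.2 ⟨a, fun v hv => ha0 v (Finset.mem_filter.1 hv).1, ?_, ?_⟩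
    · rw [Finset.sum_filter_of_ne hsupp, ha1]
    · rw [Finset.sum_filter_of_ne fun v hv h => hsupp v hv (left_ne_zero_of_smul h), hax]
  · intro y hy z hz s t hs ht hst
    refine ⟨convex_convexHull ℝ _ hy.1 hz.1 hs ht hst, fun w hw => ?_⟩
    rw [map_add, map_smul, map_smul, smul_eq_mul, smul_eq_mul]
    calc l w = s * l w + t * l w := by rw [← add_mul, hst, one_mul]
      _ ≤ s * l y + t * l z := by gcongr; exacts [hy.2 w hw, hz.2 w hw]

theorem finite_setOf_maxFace (V : Finset M) :
    {F | ∃ l, F = maxFace (convexHull ℝ (V : Set M)) l}.Finite := by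
  refine Set.Finite.subset (V.finite_toSet.finite_subsets.image (convexHull ℝ)) ?_
  rintro _ ⟨l, rfl⟩
  exact ⟨_, Set.inter_subset_left, (maxFace_convexHull V l).symm⟩

theorem mem_dualAnnihilator_vectorSpan_maxFace {V : Finset M} {l : Dual ℝ M} {x : M}
    (hx : x ∈ maxFace (convexHull ℝ (V : Set M)) l) {m : Dual ℝ M} :
    m ∈ (vectorSpan ℝ (maxFace (convexHull ℝ (V : Set M)) l)).dualAnnihilator ↔
      ∀ v ∈ V, l v = l x → m v = m x := by
  have hVP : ∀ v ∈ V, v ∈ convexHull ℝ (V : Set M) := fun v hv => subset_convexHull ℝ _ hv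
  rw [Submodule.mem_dualAnnihilator, vectorSpan_eq_span_vsub_set_right ℝ hx]
  constructor
  · intro h v hv hvx
    have := h (v -ᵥ x)
      (Submodule.subset_span ⟨v, (mem_maxFace_of_eq hx (hVP v hv)).2 hvx, rfl⟩)
    rwa [vsub_eq_sub, map_sub, sub_eq_zero] at this
  · intro h
    have hsub : maxFace (convexHull ℝ (V : Set M)) l ⊆ {y | m y = m x} := by
      rw [maxFace_convexHull]
      refine convexHull_min (fun v hv => ?_) (convex_hyperplane m.isLinear (m x))
      exact h v hv.1 ((mem_maxFace_of_eq hx (hVP v hv.1)).1 hv.2)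
    suffices Submodule.span ℝ ((· -ᵥ x) '' maxFace (convexHull ℝ (V : Set M)) l) ≤
      LinearMap.ker m from fun w hw => this hw
    rw [Submodule.span_le]
    rintro _ ⟨y, hy, rfl⟩
    have : m y = m x := hsub hy
    simp [this]

/-- The Euler relation for the faces of a polytope through a point of a proper face. -/
theorem sum_maxFace_mem [FiniteDimensional ℝ M] (V : Finset M) {x : M}
    (h : ∃ l, x ∈ maxFace (convexHull ℝ (V : Set M)) l ∧ ∃ v ∈ V, l v < l x)
    (𝒮 : Finset (Set M))
    (h𝒮 : ∀ F, F ∈ 𝒮 ↔ x ∈ F ∧ ∃ l, F = maxFace (convexHull ℝ (V : Set M)) l) :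
    ∑ F ∈ 𝒮, (-1 : ℝ) ^ finrank ℝ (vectorSpan ℝ F) = 0 := by
  classical
  set P := convexHull ℝ (V : Set M) with hP
  have hVP : ∀ v ∈ V, v ∈ P := fun v hv => subset_convexHull ℝ _ hv
  have hxP : x ∈ P := h.choose_spec.1.1
  set I : Finset M := V.filter fun v => ∃ l, x ∈ maxFace P l ∧ l v < l x with hI
  have hIne : I.Nonempty := by
    obtain ⟨l, hl, v, hv, hlv⟩ := h
    exact ⟨v, Finset.mem_filter.2 ⟨hv, l, hl, hlv⟩⟩
  have hIV : ∀ v ∈ I, v ∈ V := fun v hv => (Finset.mem_filter.1 hv).1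
  have hoff : ∀ l, x ∈ maxFace P l → ∀ v ∈ V \ I, l v = l x := by
    intro l hl v hv
    obtain ⟨hvV, hvI⟩ := Finset.mem_sdiff.1 hv
    by_contra hne
    exact hvI (Finset.mem_filter.2 ⟨hvV, l, hl, lt_of_le_of_ne (hl.2 v (hVP v hvV)) hne⟩)
  set f : M → Dual ℝ M →ₗ[ℝ] ℝ := fun v => Dual.eval ℝ M (v - x) with hf
  have hf_apply (v : M) (l : Dual ℝ M) : f v l = l v - l x := by simp [f]
  set K : Submodule ℝ (Dual ℝ M) := ⨅ v ∈ V \ I, LinearMap.ker (f v) with hK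
  have hmemK (l : Dual ℝ M) : l ∈ K ↔ ∀ v ∈ V \ I, l v = l x := by
    simp only [K, Submodule.mem_iInf, LinearMap.mem_ker, hf_apply, sub_eq_zero]
  obtain ⟨l₀, hl₀, hl₀I⟩ : ∃ l₀, x ∈ maxFace P l₀ ∧ ∀ v ∈ I, l₀ v < l₀ x := by
    choose! L hLx hLv using fun v (hv : v ∈ I) => (Finset.mem_filter.1 hv).2
    refine ⟨∑ v ∈ I, L v, ⟨hxP, fun y hy => ?_⟩, fun v hv => ?_⟩
    · simp only [LinearMap.sum_apply]
      exact Finset.sum_le_sum fun v hv => (hLx v hv).2 y hy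
    · simp only [LinearMap.sum_apply]
      exact Finset.sum_lt_sum (fun w hw => (hLx w hw).2 v (hVP v (hIV v hv))) ⟨v, hv, hLv v hv⟩
  set φ : Set M → Finset M := fun F => I.filter (· ∈ F) with hφ
  have hφ_mem {l : Dual ℝ M} (hl : x ∈ maxFace P l) {v : M} (hv : v ∈ I) :
      v ∈ φ (maxFace P l) ↔ l v = l x := by
    simp [φ, hv, mem_maxFace_of_eq hl (hVP v (hIV v hv))]
  have hcell {l : Dual ℝ M} (hl : x ∈ maxFace P l) :
      l ∈ cell K f (φ (maxFace P l)) (I \ φ (maxFace P l)) := by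
    refine ⟨(hmemK l).2 (hoff l hl), fun v hv => ?_, fun v hv => ?_⟩
    · rw [hf_apply, sub_eq_zero]
      exact (hφ_mem hl (Finset.mem_filter.1 hv).1).1 hv
    · obtain ⟨hvI, hv⟩ := Finset.mem_sdiff.1 hv
      rw [hf_apply, sub_neg]
      exact lt_of_le_of_ne (hl.2 v (hVP v (hIV v hvI))) fun h => hv ((hφ_mem hl hvI).2 h)
  have hval {l : Dual ℝ M} (hl : x ∈ maxFace P l) :
      (-1 : ℝ) ^ finrank ℝ (vectorSpan ℝ (maxFace P l)) = (-1) ^ finrank ℝ M *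
        coneEuler (cell K f (φ (maxFace P l)) (I \ φ (maxFace P l))) := by
    have hann : K ⊓ ⨅ v ∈ φ (maxFace P l), LinearMap.ker (f v) =
        (vectorSpan ℝ (maxFace P l)).dualAnnihilator := by
      ext m
      rw [mem_dualAnnihilator_vectorSpan_maxFace hl, Submodule.mem_inf, hmemK]
      simp only [Submodule.mem_iInf, LinearMap.mem_ker, hf_apply, sub_eq_zero]
      constructor
      · rintro ⟨h1, h2⟩ v hv hlv
        by_cases hvI : v ∈ I
        · exact h2 v ((hφ_mem hl hvI).2 hlv)
        · exact h1 v (Finset.mem_sdiff.2 ⟨hv, hvI⟩)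
      · intro h
        refine ⟨fun v hv => h v (Finset.mem_sdiff.1 hv).1 (hoff l hl v hv), fun v hv => ?_⟩
        have hvI := (Finset.mem_filter.1 hv).1
        exact h v (hIV v hvI) ((hφ_mem hl hvI).1 hv)
    rw [coneEuler_of_nonempty ⟨l, hcell hl⟩, span_cell K f _ _ ⟨l, hcell hl⟩, hann,
      ← Subspace.finrank_add_finrank_dualAnnihilator_eq (vectorSpan ℝ (maxFace P l)),
      pow_add, mul_assoc, ← mul_pow]
    simp
  have key : ∑ F ∈ 𝒮, (-1 : ℝ) ^ finrank ℝ (vectorSpan ℝ F) =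
      ∑ S ∈ I.powerset, (-1) ^ finrank ℝ M * coneEuler (cell K f S (I \ S)) := by
    refine Finset.sum_of_injOn φ ?_ ?_ ?_ ?_
    · intro F hF F' hF' hFF'
      obtain ⟨hx, l, rfl⟩ := (h𝒮 F).1 hF
      obtain ⟨hx', l', rfl⟩ := (h𝒮 F').1 hF'
      rw [maxFace_convexHull V l, maxFace_convexHull V l']
      congr 1
      ext v
      refine and_congr_right fun hv => ?_
      by_cases hvI : v ∈ I
      · simpa [φ, hvI] using congrArg (v ∈ ·) hFF'
      · have hv' : v ∈ V \ I := Finset.mem_sdiff.2 ⟨hv, hvI⟩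
        exact iff_of_true ((mem_maxFace_of_eq hx (hVP v hv)).2 (hoff l hx v hv'))
          ((mem_maxFace_of_eq hx' (hVP v hv)).2 (hoff l' hx' v hv'))
    · exact fun F _ => Finset.mem_powerset.2 (Finset.filter_subset _ _)
    · intro S hS hS'
      have hSI := Finset.mem_powerset.1 hS
      rcases (cell K f S (I \ S)).eq_empty_or_nonempty with h0 | ⟨l, hlK, hlS, hlT⟩
      · simp [h0]
      · refine absurd ?_ hS'
        simp only [hf_apply, sub_eq_zero, sub_neg] at hlS hlT
        have hl : x ∈ maxFace P l := by
          refine (mem_maxFace_convexHull hxP).2 fun v hv => ?_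
          by_cases hvI : v ∈ I
          · by_cases hvS : v ∈ S
            · exact (hlS v hvS).le
            · exact (hlT v (Finset.mem_sdiff.2 ⟨hvI, hvS⟩)).le
          · exact ((hmemK l).1 hlK v (Finset.mem_sdiff.2 ⟨hv, hvI⟩)).le
        refine ⟨maxFace P l, (h𝒮 _).2 ⟨hl, l, rfl⟩, ?_⟩
        ext v
        by_cases hvI : v ∈ I
        · rw [hφ_mem hl hvI]
          refine ⟨fun h => ?_, hlS v⟩
          by_contra hvS
          exact (hlT v (Finset.mem_sdiff.2 ⟨hvI, hvS⟩)).ne h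
        · exact iff_of_false (fun h => hvI (Finset.mem_filter.1 h).1) fun h => hvI (hSI h)
    · intro F hF
      obtain ⟨hx, l, rfl⟩ := (h𝒮 F).1 hF
      exact hval hx
  rw [key, ← Finset.mul_sum,
    sum_coneEuler_cell K f hIne ((hmemK l₀).2 (hoff l₀ hl₀)) fun v hv => ?_, mul_zero]
  rw [hf_apply, sub_neg]
  exact hl₀I v hv

theorem eq_of_mem_intrinsicInterior {P : Set M} {l : Dual ℝ M} {x v : M}
    (hx : x ∈ intrinsicInterior ℝ P) (hl : x ∈ maxFace P l) (hv : v ∈ P) : l v = l x := by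
  obtain ⟨y, hy, rfl⟩ := mem_intrinsicInterior.1 hx
  have hv' : v ∈ affineSpan ℝ P := subset_affineSpan ℝ P hv
  set γ : ℝ → affineSpan ℝ P := fun t =>
    ⟨AffineMap.lineMap (y : M) v (-t), AffineMap.lineMap_mem _ y.2 hv'⟩ with hγ
  have hγc : Continuous γ := by
    refine Continuous.subtype_mk ?_ _
    simp only [AffineMap.lineMap_apply_module']
    fun_prop
  have hγ0 : γ 0 = y := by ext; simp [γ]
  have hnear : ∀ᶠ t in 𝓝[>] (0 : ℝ), γ t ∈ ((↑) ⁻¹' P : Set (affineSpan ℝ P)) := by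
    refine (hγc.tendsto 0).mono_left nhdsWithin_le_nhds |>.eventually ?_
    rw [hγ0]
    exact mem_interior_iff_mem_nhds.1 hy
  obtain ⟨t, ht, ht0⟩ := (hnear.and self_mem_nhdsWithin).exists
  have ht0 : 0 < t := ht0
  refine (hl.2 v hv).antisymm ?_
  have h1 := hl.2 _ ht
  simp only [γ, AffineMap.lineMap_apply_module', map_add, map_smul, map_sub, smul_eq_mul] at h1
  nlinarith

theorem mem_intrinsicInterior_of_forall_eq [FiniteDimensional ℝ M] {P : Set M}
    (hP : Convex ℝ P) {x : M} (hx : x ∈ P)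
    (h : ∀ l : Dual ℝ M, x ∈ maxFace P l → ∀ v ∈ P, l v = l x) : x ∈ intrinsicInterior ℝ P := by
  set A := affineSpan ℝ P with hA
  set x' : A := ⟨x, subset_affineSpan ℝ P hx⟩ with hx'
  have : Nonempty A := ⟨x'⟩
  set φ : A.direction ≃ₜ A := Homeomorph.vaddConst x' with hφ
  set Q : Set A.direction := φ ⁻¹' ((↑) ⁻¹' P) with hQ
  have hmemQ (u : A.direction) : u ∈ Q ↔ (u : M) + x ∈ P := Iff.rfl
  have hQc : Convex ℝ Q := by
    intro u hu w hw s t hs ht hst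
    rw [hmemQ] at *
    convert hP hu hw hs ht hst using 1
    simp only [Submodule.coe_add, Submodule.coe_smul, smul_add]
    rw [add_add_add_comm, ← add_smul, hst, one_smul]
  have hQi : interior Q = φ ⁻¹' interior ((↑) ⁻¹' P) := (φ.preimage_interior _).symm
  have hQne : (interior Q).Nonempty := by
    obtain ⟨_, hz⟩ := Set.Nonempty.intrinsicInterior hP ⟨x, hx⟩
    obtain ⟨y, hy, -⟩ := mem_intrinsicInterior.1 hz
    exact ⟨φ.symm y, by simpa [hQi] using hy⟩
  suffices h0 : (0 : A.direction) ∈ interior Q by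
    rw [hQi] at h0
    exact mem_intrinsicInterior.2 ⟨φ 0, h0, by simp [φ, x']⟩
  by_contra h0
  obtain ⟨f, hf⟩ := geometric_hahn_banach_open_point hQc.interior isOpen_interior h0
  obtain ⟨l, hl⟩ := (f : A.direction →ₗ[ℝ] ℝ).exists_extend
  have hlf (u : A.direction) : l u = f u := LinearMap.congr_fun hl u
  have hQf : ∀ u ∈ Q, f u ≤ 0 := by
    intro u hu
    have hu' : u ∈ closure (interior Q) := by
      rw [hQc.closure_interior_eq_closure_of_nonempty_interior hQne]
      exact subset_closure hu
    refine closure_minimal (t := {u | f u ≤ 0}) (fun w hw => ?_)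
      (isClosed_le f.continuous continuous_const) hu'
    simpa using (hf w hw).le
  have hface : x ∈ maxFace P l := by
    refine ⟨hx, fun y hy => ?_⟩
    have hyx : y - x ∈ A.direction :=
      AffineSubspace.vsub_mem_direction (subset_affineSpan ℝ P hy) x'.2
    have := hQf ⟨y - x, hyx⟩ ((hmemQ _).2 (by simpa using hy))
    rw [← hlf, map_sub] at this
    linarith
  obtain ⟨u, hu⟩ := hQne
  have h1 := h l hface _ ((hmemQ u).1 (interior_subset hu))
  have h2 := hf u hu
  rw [map_zero, ← hlf] at h2
  rw [map_add] at h1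
  linarith

theorem sum_maxFace_indicator [FiniteDimensional ℝ M] (V : Finset M) (x : M) (𝒮 : Finset (Set M))
    (h𝒮 : ∀ F, F ∈ 𝒮 ↔ F.Nonempty ∧ ∃ l, F = maxFace (convexHull ℝ (V : Set M)) l) :
    ∑ F ∈ 𝒮, (-1 : ℝ) ^ finrank ℝ (vectorSpan ℝ F) * F.indicator (fun _ => (1 : ℝ)) x =
      (-1) ^ finrank ℝ (vectorSpan ℝ (convexHull ℝ (V : Set M))) *
        (intrinsicInterior ℝ (convexHull ℝ (V : Set M))).indicator (fun _ => (1 : ℝ)) x := by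
  classical
  set P := convexHull ℝ (V : Set M) with hP
  have hsum : ∑ F ∈ 𝒮, (-1 : ℝ) ^ finrank ℝ (vectorSpan ℝ F) * F.indicator (fun _ => (1 : ℝ)) x =
      ∑ F ∈ 𝒮 with x ∈ F, (-1 : ℝ) ^ finrank ℝ (vectorSpan ℝ F) := by
    simp [Finset.sum_filter, Set.indicator_apply]
  have hmem (F : Set M) : F ∈ 𝒮.filter (x ∈ ·) ↔ x ∈ F ∧ ∃ l, F = maxFace P l := by
    rw [Finset.mem_filter, h𝒮]
    exact ⟨fun h => ⟨h.2, h.1.2⟩, fun h => ⟨⟨⟨x, h.1⟩, h.2⟩, h.1⟩⟩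
  rw [hsum]
  by_cases hproper : ∃ l, x ∈ maxFace P l ∧ ∃ v ∈ V, l v < l x
  · rw [sum_maxFace_mem V hproper _ hmem, Set.indicator_of_notMem, mul_zero]
    intro hx
    obtain ⟨l, hl, v, hv, hlt⟩ := hproper
    exact hlt.ne (eq_of_mem_intrinsicInterior hx hl (subset_convexHull ℝ _ hv))
  · by_cases hx : x ∈ P
    · have hall (l : Dual ℝ M) (hl : x ∈ maxFace P l) : ∀ v ∈ P, l v = l x := by
        refine convexHull_min (fun v hv => ?_) (convex_hyperplane l.isLinear (l x))
        by_contra hne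
        exact hproper ⟨l, hl, v, hv, lt_of_le_of_ne (hl.2 v (subset_convexHull ℝ _ hv)) hne⟩
      have hfilter : 𝒮.filter (x ∈ ·) = {P} := by
        ext F
        rw [hmem, Finset.mem_singleton]
        constructor
        · rintro ⟨hxF, l, rfl⟩
          exact subset_antisymm (fun y hy => hy.1)
            fun y hy => (mem_maxFace_of_eq hxF hy).2 (hall l hxF y hy)
        · rintro rfl
          exact ⟨hx, 0, by simp [maxFace]⟩
      rw [hfilter, Finset.sum_singleton, Set.indicator_of_mem
        (mem_intrinsicInterior_of_forall_eq (convex_convexHull ℝ _) hx hall), mul_one]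
    · rw [Set.indicator_of_notMem fun h => hx (intrinsicInterior_subset h), mul_zero]
      refine Finset.sum_eq_zero fun F hF => ?_
      obtain ⟨hxF, l, rfl⟩ := (hmem F).1 hF
      exact absurd hxF.1 hx

end Face

theorem stmt_6 (d : ℕ) (V : Finset (Fin d → ℝ)) (hV : V.Nonempty)
    (P : Set (Fin d → ℝ)) (hP : P = convexHull ℝ (↑V : Set (Fin d → ℝ)))
    (ℱ : Set (Set (Fin d → ℝ)))
    (hℱ : ℱ = {F | F.Nonempty ∧ ∃ l : Fin d → ℝ,
      F = {x ∈ P | ∀ y ∈ P, ∑ j, l j * y j ≤ ∑ j, l j * x j}}) :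
    ℱ.Finite ∧
      ∀ x : Fin d → ℝ,
        (∑ᶠ F ∈ ℱ, ((-1 : ℝ)) ^ (Module.finrank ℝ (vectorSpan ℝ F)) *
            Set.indicator F (fun _ => (1 : ℝ)) x)
          = ((-1 : ℝ)) ^ (Module.finrank ℝ (vectorSpan ℝ P)) *
              Set.indicator (intrinsicInterior ℝ P) (fun _ => (1 : ℝ)) x := by
  have hface (F : Set (Fin d → ℝ)) :
      F ∈ ℱ ↔ F.Nonempty ∧ ∃ l, F = maxFace (convexHull ℝ (V : Set (Fin d → ℝ))) l := by
    subst hℱ hP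
    refine and_congr_right fun _ => ?_
    rw [(dotProductEquiv ℝ (Fin d)).surjective.exists]
    rfl
  have hfin : ℱ.Finite := (finite_setOf_maxFace V).subset fun F hF => ((hface F).1 hF).2
  refine ⟨hfin, fun x => ?_⟩
  rw [finsum_mem_eq_finite_toFinset_sum _ hfin, hP]
  exact sum_maxFace_indicator V x _ fun F => by rw [hfin.mem_toFinset, hface]
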